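/- arXiv:math/9811073 — 2 statements merged into one kernel-verified Lean document; each statement's English description precedes it below -/
import Mathlib

section
/- Let v, v1, v2, v3, v4 be distinct points in ℝ³ with all pairwise distances at least 2, and suppose |vi − vj| ≤ 2.51 for all pairs {i,j} ⊆ {1,2,3,4} with {i,j} ≠ {1,4}. Then v does not lie in the convex hull of {v1, v2, v3, v4}. -/
/-- Two points at distance at least 2 from `v` and at most 2.51 from each other subtend
an acute angle at `v`. -/
lemma inner_pos_of_close (v a b : EuclideanSpace ℝ (Fin 3)) (ha : 2 ≤ dist v a)
    (hb : 2 ≤ dist v b) (hab : dist a b ≤ 2.51) :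
    inner ℝ (a - v) v < inner ℝ (a - v) b := by
  rw [dist_comm, dist_eq_norm] at ha hb
  rw [dist_eq_norm] at hab
  have e : a - b = (a - v) - (b - v) := by abel
  have h := norm_sub_sq_real (a - v) (b - v)
  rw [← e] at h
  have h2 : inner ℝ (a - v) (b - v) = inner ℝ (a - v) b - inner ℝ (a - v) v :=
    inner_sub_right _ _ _
  have h3 : ‖a - b‖ ^ 2 ≤ 2.51 ^ 2 := pow_le_pow_left₀ (norm_nonneg _) hab 2
  norm_num at h3
  nlinarith

/-- If v, v1, v2, v3, v4 are distinct points of ℝ³ with all pairwise distances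
at least 2, and |vi − vj| ≤ 2.51 for all pairs {i,j} ⊆ {1,2,3,4} except {1,4},
then v does not lie in the convex hull of {v1, v2, v3, v4}. -/
theorem not_mem_convexHull_of_close_neighbors
    (v v1 v2 v3 v4 : EuclideanSpace ℝ (Fin 3))
    (hdist : ∀ p ∈ ({v, v1, v2, v3, v4} : Set (EuclideanSpace ℝ (Fin 3))),
      ∀ q ∈ ({v, v1, v2, v3, v4} : Set (EuclideanSpace ℝ (Fin 3))),
      p ≠ q → 2 ≤ dist p q)
    (hne : v ≠ v1 ∧ v ≠ v2 ∧ v ≠ v3 ∧ v ≠ v4 ∧ v1 ≠ v2 ∧ v1 ≠ v3 ∧ v1 ≠ v4 ∧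
      v2 ≠ v3 ∧ v2 ≠ v4 ∧ v3 ≠ v4)
    (h12 : dist v1 v2 ≤ 2.51) (h13 : dist v1 v3 ≤ 2.51)
    (h23 : dist v2 v3 ≤ 2.51) (h24 : dist v2 v4 ≤ 2.51)
    (h34 : dist v3 v4 ≤ 2.51) :
    v ∉ convexHull ℝ ({v1, v2, v3, v4} : Set (EuclideanSpace ℝ (Fin 3))) := by
  obtain ⟨n1, n2, n3, n4, -⟩ := hne
  have d1 : 2 ≤ dist v v1 := hdist v (by simp) v1 (by simp) n1
  have d2 : 2 ≤ dist v v2 := hdist v (by simp) v2 (by simp) n2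
  have d3 : 2 ≤ dist v v3 := hdist v (by simp) v3 (by simp) n3
  have d4 : 2 ≤ dist v v4 := hdist v (by simp) v4 (by simp) n4
  intro hv
  have hconv : Convex ℝ {x : EuclideanSpace ℝ (Fin 3) |
      inner ℝ (v2 - v) v < inner ℝ (v2 - v) x} :=
    convex_halfSpace_gt (innerₛₗ ℝ (v2 - v)).isLinear _
  have hsub : ({v1, v2, v3, v4} : Set (EuclideanSpace ℝ (Fin 3))) ⊆
      {x | inner ℝ (v2 - v) v < inner ℝ (v2 - v) x} := by
    rintro x (rfl | rfl | rfl | rfl)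
    · exact inner_pos_of_close v v2 _ d2 d1 (by rwa [dist_comm])
    · exact inner_pos_of_close v _ _ d2 d2 (by rw [dist_self]; norm_num)
    · exact inner_pos_of_close v v2 _ d2 d3 h23
    · exact inner_pos_of_close v v2 _ d2 d4 h24
  have hlt : inner ℝ (v2 - v) v < inner ℝ (v2 - v) v := convexHull_min hsub hconv hv
  exact lt_irrefl _ hlt
end

section
/- Consider a triangulation of the sphere satisfying: every vertex has degree 4, 5, or 6; 13 ≤ N ≤ 15; no two degree-4 vertices are adjacent; N4 ≤ 2; there are no three pairwise nonadjacent degree-6 vertices and no pattern (6,6,4); any pattern (6,6) or (6,4,4) implies N ≥ 14; two adjacent degree-6 vertices plus a third degree-6 vertex adjacent to neither force N = 15 with all other vertices adjacent to one of the three; any region bounded by three edges is a single triangle or the complement of one. Then the triangulation is the unique one with 14 vertices and 24 triangles consisting of two antipodal degree-6 vertices each surrounded by a hexagon, with a band of 12 triangles between the hexagons. -/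
open Finset

/-- The triangulation of Diagram 6.2: 14 vertices, two "polar" degree-6
vertices (0 and 1), each surrounded by a hexagon (2,...,7 around 0 and
8,...,13 around 1), with an antiprismatic band of 12 triangles between the
two hexagons.  Every other vertex has degree 5. -/
def targetGraph : SimpleGraph (Fin 14) :=
  SimpleGraph.fromRel (fun i j => (i, j) ∈
    ([ (0,2), (0,3), (0,4), (0,5), (0,6), (0,7),
       (1,8), (1,9), (1,10), (1,11), (1,12), (1,13),
       (2,3), (3,4), (4,5), (5,6), (6,7), (7,2),
       (8,9), (9,10), (10,11), (11,12), (12,13), (13,8),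
       (2,8), (3,9), (4,10), (5,11), (6,12), (7,13),
       (2,9), (3,10), (4,11), (5,12), (6,13), (7,8) ] : List (Fin 14 × Fin 14)))

namespace TriSearch

/-- Apply `f` to `n`, evaluating the argument first. -/
def force (n : ℕ) (f : ℕ → Bool) : Bool :=
  Nat.rec (f 0) (fun p _ => f (Nat.succ p)) n

/-- Disjunction, by the recursor. -/
def orr (a b : Bool) : Bool := Bool.rec b true a
/-- Conjunction, by the recursor. -/
def andd (a b : Bool) : Bool := Bool.rec false b a
/-- Conjunction with a negation, by the recursor. -/
def butnot (a b : Bool) : Bool := Bool.rec b false a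

/-- At least one set bit. -/
def ge1 (m : ℕ) : Bool := Nat.rec false (fun _ _ => true) m
/-- At least two set bits. -/
def ge2 (m : ℕ) : Bool := Nat.rec false (fun p _ => ge1 (Nat.land p (Nat.succ p))) m
/-- At least three set bits. -/
def ge3 (m : ℕ) : Bool := Nat.rec false (fun p _ => ge2 (Nat.land p (Nat.succ p))) m
/-- At least four set bits. -/
def ge4 (m : ℕ) : Bool := Nat.rec false (fun p _ => ge3 (Nat.land p (Nat.succ p))) m
/-- At least five set bits. -/
def ge5 (m : ℕ) : Bool := Nat.rec false (fun p _ => ge4 (Nat.land p (Nat.succ p))) m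
/-- At least six set bits. -/
def ge6 (m : ℕ) : Bool := Nat.rec false (fun p _ => ge5 (Nat.land p (Nat.succ p))) m
/-- At least seven set bits. -/
def ge7 (m : ℕ) : Bool := Nat.rec false (fun p _ => ge6 (Nat.land p (Nat.succ p))) m
/-- At least eight set bits. -/
def ge8 (m : ℕ) : Bool := Nat.rec false (fun p _ => ge7 (Nat.land p (Nat.succ p))) m
/-- At least nine set bits. -/
def ge9 (m : ℕ) : Bool := Nat.rec false (fun p _ => ge8 (Nat.land p (Nat.succ p))) m
/-- At least ten set bits. -/
def ge10 (m : ℕ) : Bool := Nat.rec false (fun p _ => ge9 (Nat.land p (Nat.succ p))) m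
/-- At least eleven set bits. -/
def ge11 (m : ℕ) : Bool := Nat.rec false (fun p _ => ge10 (Nat.land p (Nat.succ p))) m
/-- At least twelve set bits. -/
def ge12 (m : ℕ) : Bool := Nat.rec false (fun p _ => ge11 (Nat.land p (Nat.succ p))) m

/-- Remove the check sum. -/
def body (S : ℕ) : ℕ := Nat.shiftRight S 64

/-- Attach a check sum in the 64 lowest bits (this keeps the hash values of literals apart). -/
def stamp (M : ℕ) : ℕ :=
  Nat.add (Nat.mul M 18446744073709551616) (Nat.mod M 18446744073709551557)

/-- Row `v` of a bit matrix with 16 columns. -/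
def row (M v : ℕ) : ℕ := Nat.mod (Nat.shiftRight (body M) (Nat.mul 16 v)) 65536

/-- The entry `(i, j)` of the bit matrix. -/
def tb (M i j : ℕ) : Bool :=
  Nat.beq (Nat.mod (Nat.shiftRight (body M) (Nat.add (Nat.mul 16 i) j)) 2) 1

/-- Known common neighbours. -/
def cm (M a b : ℕ) : ℕ := Nat.land (row M a) (row M b)

/-- `f` holds below `n`. -/
def allLt (n : ℕ) (f : ℕ → Bool) : Bool :=
  Nat.rec true (fun i ih => Bool.rec false ih (f i)) n

/-- Hand the list of the numbers below `n` with `f` (followed by `acc`) to `c`. -/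
def withList (f : ℕ → Bool) (c : List ℕ → Bool) (n : ℕ) : List ℕ → Bool :=
  Nat.rec (fun acc => c acc)
    (fun i ih acc => Bool.rec (ih acc) (ih (i :: acc)) (f i)) n

/-- `f` holds for some member. -/
def anyL (l : List ℕ) (f : ℕ → Bool) : Bool :=
  List.rec false (fun i _ ih => Bool.rec ih true (f i)) l

/-- Copy the row `r` into all rows. -/
def rep (r : ℕ) : ℕ :=
  Nat.mul r 1766874025136433896750911497805568136923323180981774075523881651146915841

/-- Keep column `v` only, and fill the rows in which it is set. -/
def smear (M v : ℕ) : ℕ :=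
  Nat.mul (Nat.land (Nat.shiftRight (body M) v)
    1766874025136433896750911497805568136923323180981774075523881651146915841) 65535

/-- The known part of the link of `v` (each link edge twice), where `r` is row `v`. -/
def link (M v r : ℕ) : ℕ := Nat.land (Nat.land (body M) (rep r)) (smear M v)

/-- The link of `v` is a known 4-cycle. -/
def closed4 (M v r : ℕ) : Bool := ge8 (link M v r)
/-- The link of `v` is a known 5-cycle. -/
def closed5 (M v r : ℕ) : Bool := ge10 (link M v r)
/-- The link of `v` is a known 6-cycle. -/
def closed6 (M v r : ℕ) : Bool := ge12 (link M v r)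

/-- The link of `v` is a known cycle. -/
def closedR (M v r : ℕ) : Bool :=
  Bool.rec (Bool.rec (andd (ge4 r) (closed4 M v r)) (closed5 M v r) (ge5 r))
    (closed6 M v r) (ge6 r)

/-- Certified degree 6. -/
def is6 (M v : ℕ) : Bool := ge6 (row M v)

/-- Certified degree 4. -/
def is4 (M v : ℕ) : Bool :=
  force (row M v) (fun r => butnot (ge5 r) (andd (ge4 r) (closed4 M v r)))

/-- The union of three closed neighbourhoods. -/
def cover (M a b c : ℕ) : ℕ :=
  Nat.lor (Nat.lor (Nat.lor (row M a) (row M b)) (row M c))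
    (Nat.lor (Nat.lor (Nat.pow 2 a) (Nat.pow 2 b)) (Nat.pow 2 c))

/-- If `c` is different from and not joined to `a`, then `t`. -/
def sep (M a c : ℕ) (t : Bool) : Bool := butnot (Nat.beq a c) (butnot (tb M a c) t)

/-- A forbidden pattern with the two non-adjacent sixes `a`, `b`. -/
def pat66 (N M : ℕ) (l4 l6 : List ℕ) (a b : ℕ) : Bool :=
  orr (Nat.beq N 13)
    (orr (anyL l6 (fun c => sep M a c (sep M b c true)))
      (anyL l4 (fun c => sep M a c (sep M b c true))))

/-- The pattern with the two adjacent sixes `a`, `b` and a separate six. -/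
def patAdj (N M : ℕ) (l6 : List ℕ) (a b : ℕ) : Bool :=
  anyL l6 (fun c => sep M a c (sep M b c
    (Bool.rec true (Bool.rec true false (Nat.beq (cover M a b c) 32767)) (Nat.beq N 15))))

/-- Forbidden patterns among the labels of known degree 4 (`l4`) and 6 (`l6`). -/
def pat (N m M : ℕ) (l4 l6 : List ℕ) : Bool :=
  orr (List.rec false (fun _ t _ => List.rec false (fun _ t' _ =>
      List.rec false (fun _ _ _ => true) t') t) l4)
  (orr (List.rec false (fun _ _ _ => Nat.beq m 0) l4)
  (orr (anyL l4 (fun a => anyL l4 (fun b => tb M a b)))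
  (anyL l6 (fun a => anyL l6 (fun b =>
    Bool.rec (Bool.rec (pat66 N M l4 l6 a b) false (Nat.beq a b)) (patAdj N M l6 a b)
      (tb M a b))))))

/-- Contradictions near the new triangle `a b x`. -/
def badLocal (M a b x : ℕ) : Bool :=
  orr (ge3 (cm M a x)) (orr (ge3 (cm M b x)) (orr (ge1 (Nat.land (cm M a b) (row M x)))
  (orr (ge7 (row M x)) (orr (ge7 (row M a)) (ge7 (row M b))))))

/-- The root does not have degree `R`. -/
def rootBad (R M : ℕ) : Bool := force (row M 0) (fun r =>
  Bool.rec (butnot (ge6 r) (closedR M 0 r)) (ge5 r) (Nat.beq R 4))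

/-- Global contradictions. -/
def bad (N m R M k : ℕ) : Bool :=
  orr (Nat.blt N k) (orr (rootBad R M)
    (withList (is4 M) (fun l4 => withList (is6 M) (fun l6 => pat N m M l4 l6) k []) k []))

/-- Add an edge. -/
def addE (M a x : ℕ) : ℕ :=
  Nat.lor (Nat.lor M (Nat.pow 2 (Nat.add (Nat.mul 16 a) x)))
    (Nat.pow 2 (Nat.add (Nat.mul 16 x) a))

/-- A neighbour `b` of `a` below `n` such that `a b` has less than two common neighbours. -/
def findB (M a n : ℕ) : Option ℕ :=
  Nat.rec none (fun b ih => Bool.rec ih (Bool.rec (some b) ih (ge2 (cm M a b))) (tb M a b)) n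

/-- An edge `(a, b)`, `a ≥ s`, with fewer than two known common neighbours. -/
def findOpen (M : ℕ) (f : ℕ) : ℕ → Option (ℕ × ℕ) :=
  Nat.rec (fun _ => none) (fun _ ih s =>
    Option.rec (ih (Nat.succ s)) (fun b => some (s, b)) (findB M s 15)) f

/-- The bit matrix of the target. -/
def target : ℕ := 3317402872431759993188094999219107871599697905854549395580578496638

/-- The number of labels after `x` was used. -/
def newK (k x : ℕ) : ℕ := Bool.rec k (Nat.succ k) (Nat.beq x k)

/-- The end of the search. -/
def leaf (N M k : ℕ) : Bool :=
  andd (allLt k (fun v => force (row M v) (closedR M v)))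
    (orr (andd (Nat.blt k N) (Nat.ble N (Nat.add k 5)))
      (andd (Nat.beq N 14) (andd (Nat.beq k 14) (Nat.beq (body M) target))))

/-- No admissible triangulation other than the target extends the partial one. -/
def go (N m R : ℕ) (f : ℕ) : ℕ → ℕ → ℕ → Bool :=
  Nat.rec (fun _ _ _ => false) (fun _ ih M k s =>
    Option.rec (leaf N M k)
      (fun p => force p.1 (fun a => force p.2 (fun b => allLt (Nat.succ k) (fun x =>
        orr (Nat.beq x a) (orr (Nat.beq x b) (orr (andd (tb M a x) (tb M b x))
        (force (stamp (addE (addE (body M) a x) b x)) (fun M' => orr (badLocal M' a b x)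
          (force (newK k x) (fun k' => orr (bad N m R M' k') (ih M' k' a)))))))))))
      (findOpen M (Nat.sub k s) s)) f

/-- A single edge. -/
def start : ℕ := 1208962713102776593874946


section basics

theorem force_eq (n : ℕ) (f : ℕ → Bool) : force n f = f n := by
  cases n <;> rfl

theorem orr_iff (a b : Bool) : orr a b = true ↔ a = true ∨ b = true := by
  cases a <;> cases b <;> simp [orr]

theorem andd_iff (a b : Bool) : andd a b = true ↔ a = true ∧ b = true := by
  cases a <;> cases b <;> simp [andd]

theorem butnot_iff (a b : Bool) : butnot a b = true ↔ a = false ∧ b = true := by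
  cases a <;> cases b <;> simp [butnot]

theorem rec_iff (a b c : Bool) : (Bool.rec a b c : Bool) = true ↔
    (c = true ∧ b = true) ∨ (c = false ∧ a = true) := by
  cases c <;> simp

theorem allLt_iff (n : ℕ) (f : ℕ → Bool) : allLt n f = true ↔ ∀ i < n, f i = true := by
  induction n with
  | zero => simp [allLt]
  | succ n ih =>
    have : allLt (n + 1) f = (Bool.rec false (allLt n f) (f n) : Bool) := rfl
    rw [this, rec_iff, ih]
    constructor
    · rintro (⟨h1, h2⟩ | ⟨_, h⟩)
      · intro i hi
        rcases Nat.lt_succ_iff_lt_or_eq.1 hi with h | rfl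
        · exact h2 i h
        · exact h1
      · cases h
    · intro h
      exact Or.inl ⟨h n (by omega), fun i hi => h i (by omega)⟩

theorem anyL_iff (l : List ℕ) (f : ℕ → Bool) : anyL l f = true ↔ ∃ i ∈ l, f i = true := by
  induction l with
  | nil => simp [anyL]
  | cons a l ih =>
    have : anyL (a :: l) f = (Bool.rec (anyL l f) true (f a) : Bool) := rfl
    rw [this, rec_iff, ih]
    cases h : f a <;> simp [h]

theorem withList_eq (f : ℕ → Bool) (c : List ℕ → Bool) (n : ℕ) (acc : List ℕ) :
    withList f c n acc = c ((List.range n).filter f ++ acc) := by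
  induction n generalizing acc with
  | zero => simp [withList]
  | succ n ih =>
    have : withList f c (n + 1) acc =
      (Bool.rec (withList f c n acc) (withList f c n (n :: acc)) (f n) : Bool) := rfl
    rw [this, List.range_succ, List.filter_append]
    cases h : f n <;> simp [ih, h]

/-- The set bits of a number. -/
def bs (m : ℕ) : Finset ℕ := (Finset.range m).filter (fun i => m.testBit i = true)

theorem mem_bs (m i : ℕ) : i ∈ bs m ↔ m.testBit i = true := by
  simp only [bs, Finset.mem_filter, Finset.mem_range, and_iff_right_iff_imp]
  intro h
  exact lt_of_lt_of_le Nat.lt_two_pow_self (Nat.ge_two_pow_of_testBit h)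

theorem clear_low (p : ℕ) : ∃ l, (p + 1).testBit l = true ∧
    ∀ i, (Nat.land p (p + 1)).testBit i = ((p + 1).testBit i && !decide (i = l)) := by
  induction p using Nat.strong_induction_on with
  | _ p ih =>
    have hl : ∀ i, (Nat.land p (p + 1)).testBit i = (p.testBit i && (p + 1).testBit i) :=
      fun i => Nat.testBit_land p (p + 1) i
    rcases Nat.even_or_odd' p with ⟨q, rfl | rfl⟩
    · refine ⟨0, by simp [Nat.testBit_zero], fun i => ?_⟩
      rw [hl]
      cases i with
      | zero => simp [Nat.testBit_zero]
      | succ i =>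
        rw [Nat.testBit_succ, Nat.testBit_succ]
        have : (2 * q + 1) / 2 = q := by omega
        have h2 : 2 * q / 2 = q := by omega
        simp [this, h2]
    · obtain ⟨l, h1, h2⟩ := ih q (by omega)
      have e1 : (2 * q + 1) / 2 = q := by omega
      have e2 : (2 * q + 1 + 1) / 2 = q + 1 := by omega
      refine ⟨l + 1, by rw [Nat.testBit_succ, e2]; exact h1, fun i => ?_⟩
      rw [hl]
      cases i with
      | zero =>
        have : (2 * q + 1 + 1) % 2 = 0 := by omega
        simp [Nat.testBit_zero, this]
      | succ i =>
        rw [Nat.testBit_succ, Nat.testBit_succ, e1, e2]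
        have := h2 i
        rw [show (Nat.land q (q + 1)).testBit i = (q.testBit i && (q + 1).testBit i) from
          Nat.testBit_land q (q + 1) i] at this
        rw [this]
        simp

theorem bs_zero : bs 0 = ∅ := rfl

theorem bs_step (p : ℕ) : (bs (p + 1)).card = (bs (Nat.land p (p + 1))).card + 1 := by
  obtain ⟨l, h1, h2⟩ := clear_low p
  have : bs (p + 1) = insert l (bs (Nat.land p (p + 1))) := by
    ext i
    rw [Finset.mem_insert, mem_bs, mem_bs, h2]
    by_cases h : i = l
    · subst h; simp [h1]
    · simp [h]
  rw [this, Finset.card_insert_of_notMem]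
  rw [mem_bs, h2]
  simp

theorem ge1_iff (m : ℕ) : ge1 m = true ↔ 1 ≤ (bs m).card := by
  cases m with
  | zero => simp [ge1, bs_zero]
  | succ p => rw [bs_step]; simp [ge1]

theorem ge_step (g h : ℕ → Bool) (j : ℕ) (hg : ∀ m, g m = true ↔ j ≤ (bs m).card)
    (h0 : h 0 = false) (hs : ∀ p, h (p + 1) = g (Nat.land p (p + 1))) (m : ℕ) :
    h m = true ↔ j + 1 ≤ (bs m).card := by
  cases m with
  | zero => simp [h0, bs_zero]
  | succ p => rw [hs, bs_step, hg]; omega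

theorem ge2_iff (m : ℕ) : ge2 m = true ↔ 2 ≤ (bs m).card :=
  ge_step _ _ _ ge1_iff rfl (fun _ => rfl) m
theorem ge3_iff (m : ℕ) : ge3 m = true ↔ 3 ≤ (bs m).card :=
  ge_step _ _ _ ge2_iff rfl (fun _ => rfl) m
theorem ge4_iff (m : ℕ) : ge4 m = true ↔ 4 ≤ (bs m).card :=
  ge_step _ _ _ ge3_iff rfl (fun _ => rfl) m
theorem ge5_iff (m : ℕ) : ge5 m = true ↔ 5 ≤ (bs m).card :=
  ge_step _ _ _ ge4_iff rfl (fun _ => rfl) m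
theorem ge6_iff (m : ℕ) : ge6 m = true ↔ 6 ≤ (bs m).card :=
  ge_step _ _ _ ge5_iff rfl (fun _ => rfl) m
theorem ge7_iff (m : ℕ) : ge7 m = true ↔ 7 ≤ (bs m).card :=
  ge_step _ _ _ ge6_iff rfl (fun _ => rfl) m
theorem ge8_iff (m : ℕ) : ge8 m = true ↔ 8 ≤ (bs m).card :=
  ge_step _ _ _ ge7_iff rfl (fun _ => rfl) m
theorem ge9_iff (m : ℕ) : ge9 m = true ↔ 9 ≤ (bs m).card :=
  ge_step _ _ _ ge8_iff rfl (fun _ => rfl) m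
theorem ge10_iff (m : ℕ) : ge10 m = true ↔ 10 ≤ (bs m).card :=
  ge_step _ _ _ ge9_iff rfl (fun _ => rfl) m
theorem ge11_iff (m : ℕ) : ge11 m = true ↔ 11 ≤ (bs m).card :=
  ge_step _ _ _ ge10_iff rfl (fun _ => rfl) m
theorem ge12_iff (m : ℕ) : ge12 m = true ↔ 12 ≤ (bs m).card :=
  ge_step _ _ _ ge11_iff rfl (fun _ => rfl) m

theorem body_eq (S : ℕ) : body S = S / 2 ^ 64 := Nat.shiftRight_eq_div_pow S 64

theorem body_stamp (Y : ℕ) : body (stamp Y) = Y := by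
  rw [body_eq]
  have : stamp Y = Y * 18446744073709551616 + Y % 18446744073709551557 := rfl
  rw [this]
  have h : Y % 18446744073709551557 < 18446744073709551557 := Nat.mod_lt _ (by norm_num)
  generalize Y % 18446744073709551557 = z at h
  norm_num
  omega

theorem tb_iff (M i j : ℕ) : tb M i j = true ↔ (body M).testBit (16 * i + j) = true := by
  have : tb M i j = Nat.beq (((body M) >>> (16 * i + j)) % 2) 1 := rfl
  rw [this, Nat.beq_eq, Nat.testBit_eq_decide_div_mod_eq, Nat.shiftRight_eq_div_pow]
  simp

theorem mem_row (M v j : ℕ) :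
    j ∈ bs (row M v) ↔ j < 16 ∧ (body M).testBit (16 * v + j) = true := by
  have : row M v = ((body M) >>> (16 * v)) % 2 ^ 16 := rfl
  rw [mem_bs, this, Nat.testBit_mod_two_pow, Nat.testBit_shiftRight]
  simp

theorem mem_cm (M a b j : ℕ) : j ∈ bs (cm M a b) ↔ j ∈ bs (row M a) ∧ j ∈ bs (row M b) := by
  have : cm M a b = row M a &&& row M b := rfl
  rw [mem_bs, mem_bs, mem_bs, this, Nat.testBit_land]
  simp

theorem addE_testBit (M a x n : ℕ) : (addE M a x).testBit n = true ↔
    M.testBit n = true ∨ n = 16 * a + x ∨ n = 16 * x + a := by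
  have : addE M a x = (M ||| 2 ^ (16 * a + x)) ||| 2 ^ (16 * x + a) := rfl
  rw [this, Nat.testBit_or, Nat.testBit_or, Nat.testBit_two_pow, Nat.testBit_two_pow]
  simp only [Bool.or_eq_true, decide_eq_true_eq]
  constructor
  · rintro ((h | h) | h) <;> simp [h]
  · rintro (h | h | h) <;> simp [h]

/-- Sums of powers of `2 ^ 16`. -/
def ones : ℕ → ℕ
  | 0 => 0
  | c + 1 => 1 + 2 ^ 16 * ones c

theorem ones16 : ones 16 =
    1766874025136433896750911497805568136923323180981774075523881651146915841 := by
  norm_num [ones]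

theorem testBit_split (q r n : ℕ) (hr : r < 2 ^ 16) :
    (2 ^ 16 * q + r).testBit n = if n < 16 then r.testBit n else q.testBit (n - 16) :=
  Nat.testBit_two_pow_mul_add q hr n

theorem rep_ones (r : ℕ) (hr : r < 2 ^ 16) (c n : ℕ) (h : (r * ones c).testBit n = true) :
    r.testBit (n % 16) = true := by
  induction c generalizing n with
  | zero => simp [ones] at h
  | succ c ih =>
    have e : r * ones (c + 1) = 2 ^ 16 * (r * ones c) + r := by simp only [ones]; ring
    rw [e, testBit_split _ _ _ hr] at h
    split_ifs at h with hn
    · rwa [Nat.mod_eq_of_lt hn]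
    · have := ih _ h
      rwa [show (n - 16) % 16 = n % 16 by omega] at this

theorem smear_bit (q n : ℕ) (hq : ∀ i, q.testBit i = true → i % 16 = 0)
    (h : (q * 65535).testBit n = true) : q.testBit (16 * (n / 16)) = true := by
  induction q using Nat.strong_induction_on generalizing n with
  | _ q ih =>
    by_cases h0 : q = 0
    · subst h0; simp at h
    have hr : q % 2 ^ 16 = 0 ∨ q % 2 ^ 16 = 1 := by
      by_cases hb : q.testBit 0 = true
      · right
        apply Nat.eq_of_testBit_eq
        intro i
        rw [Nat.testBit_mod_two_pow]
        cases i with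
        | zero => simpa using hb
        | succ i =>
          rw [Nat.testBit_one_eq_true_iff_self_eq_zero.not.2 (by omega) |> Bool.eq_false_iff.2]
          by_contra hc
          simp only [Bool.not_eq_false, Bool.and_eq_true, decide_eq_true_eq] at hc
          have := hq _ hc.2
          omega
      · left
        apply Nat.eq_of_testBit_eq
        intro i
        rw [Nat.testBit_mod_two_pow, Nat.zero_testBit]
        by_contra hc
        simp only [Bool.not_eq_false, Bool.and_eq_true, decide_eq_true_eq] at hc
        have := hq _ hc.2
        have : i = 0 := by omega
        subst this
        exact hb hc.2
    have hdm := Nat.div_add_mod q (2 ^ 16)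
    have hlt : q / 2 ^ 16 < q := Nat.div_lt_self (by omega) (by norm_num)
    have hrl : q % 2 ^ 16 < 2 ^ 16 := Nat.mod_lt _ (by norm_num)
    have e : q * 65535 = 2 ^ 16 * (q / 2 ^ 16 * 65535) + q % 2 ^ 16 * 65535 := by
      conv_lhs => rw [← hdm]
      ring
    rw [e, testBit_split _ _ _ (by rcases hr with h | h <;> rw [h] <;> norm_num)] at h
    split_ifs at h with hn
    · have hn0 : n / 16 = 0 := by omega
      rw [hn0]
      rcases hr with h' | h'
      · rw [h'] at h; simp at h
      · have : q % 2 = 1 := by omega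
        simp [Nat.testBit_zero, this]
    · have hb : ∀ i, (q / 2 ^ 16).testBit i = q.testBit (i + 16) := by
        intro i
        rw [Nat.testBit_div_two_pow]
      have := ih _ hlt (n - 16) (fun i hi => by
        rw [hb] at hi
        have := hq _ hi
        omega) h
      rw [hb] at this
      rwa [show 16 * ((n - 16) / 16) + 16 = 16 * (n / 16) by omega] at this

theorem link_bit (M v r n : ℕ) (hr : r < 2 ^ 16) (h : (link M v r).testBit n = true) :
    (body M).testBit n = true ∧ r.testBit (n % 16) = true ∧
      (body M).testBit (16 * (n / 16) + v) = true := by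
  have e : link M v r = ((body M) &&& (r * ones 16)) &&&
      (((body M) >>> v &&& ones 16) * 65535) := by rw [ones16]; rfl
  rw [e, Nat.testBit_land, Nat.testBit_land] at h
  simp only [Bool.and_eq_true] at h
  obtain ⟨⟨h1, h2⟩, h3⟩ := h
  refine ⟨h1, rep_ones _ hr _ _ h2, ?_⟩
  have := smear_bit _ _ (fun i hi => by
    rw [Nat.testBit_land] at hi
    simp only [Bool.and_eq_true] at hi
    have := rep_ones 1 (by norm_num) 16 i (by simpa using hi.2)
    exact Nat.testBit_one_eq_true_iff_self_eq_zero.1 this) h3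
  rw [Nat.testBit_land, Nat.testBit_shiftRight] at this
  simp only [Bool.and_eq_true] at this
  rw [add_comm]
  exact this.1

end basics

section graph

set_option linter.unusedSectionVars false

variable {V : Type*} [Fintype V] [DecidableEq V]

/-- The properties of a triangulation used in the search. -/
structure Tri (G : SimpleGraph V) [DecidableRel G.Adj] (N : ℕ) : Prop where
  card : Fintype.card V = N
  hN : N ≤ 15
  c2 : ∀ x y, G.Adj x y → (G.neighborFinset x ∩ G.neighborFinset y).card = 2
  k4 : ∀ a b c d, G.Adj a b → G.Adj a c → G.Adj a d → G.Adj b c → G.Adj b d → G.Adj c d → False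
  d4 : ∀ v, 4 ≤ G.degree v
  d6 : ∀ v, G.degree v ≤ 6
  h44 : ∀ v w, G.Adj v w → ¬(G.degree v = 4 ∧ G.degree w = 4)
  n4 : ∀ a b c, a ≠ b → a ≠ c → b ≠ c → G.degree a = 4 → G.degree b = 4 → G.degree c = 4 → False
  h666 : ∀ a b c, a ≠ b → a ≠ c → b ≠ c → ¬G.Adj a b → ¬G.Adj a c → ¬G.Adj b c →
    G.degree a = 6 → G.degree b = 6 → G.degree c = 6 → False
  h664 : ∀ a b c, a ≠ b → a ≠ c → b ≠ c → ¬G.Adj a b → ¬G.Adj a c → ¬G.Adj b c →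
    G.degree a = 6 → G.degree b = 6 → G.degree c = 4 → False
  h66 : ∀ a b, a ≠ b → ¬G.Adj a b → G.degree a = 6 → G.degree b = 6 → N ≠ 13
  h518 : ∀ a b c : V, G.Adj a b → G.degree a = 6 → G.degree b = 6 →
      G.degree c = 6 → c ≠ a → c ≠ b → ¬G.Adj c a → ¬G.Adj c b →
      N = 15 ∧ ∀ v : V, v ≠ a → v ≠ b → v ≠ c → G.Adj v a ∨ G.Adj v b ∨ G.Adj v c

/-- The labels below `k` are realised by `φ`, and the bits of `Y` by edges. -/
structure Emb (G : SimpleGraph V) (φ : ℕ → V) (Y k : ℕ) : Prop where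
  hk : k ≤ 16
  inj : ∀ i < k, ∀ j < k, φ i = φ j → i = j
  sym : ∀ i < 16, ∀ j < 16, Y.testBit (16 * i + j) = true → Y.testBit (16 * j + i) = true
  adj : ∀ i, ∀ j < 16, Y.testBit (16 * i + j) = true → i < k ∧ j < k ∧ G.Adj (φ i) (φ j)

variable {G : SimpleGraph V} [DecidableRel G.Adj] {N : ℕ}

theorem closed_lemma (T : Tri G N) (v : V) (S : Finset V) (hS : S ⊆ G.neighborFinset v)
    (h4 : 4 ≤ S.card) (P : Finset (V × V))
    (hP : ∀ p ∈ P, p.1 ∈ S ∧ p.2 ∈ S ∧ G.Adj p.1 p.2) (hc : 2 * S.card ≤ P.card) :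
    S = G.neighborFinset v := by
  by_contra hne
  obtain ⟨y, hy, hyS⟩ : ∃ y ∈ G.neighborFinset v, y ∉ S := by
    by_contra hcon
    push Not at hcon
    exact hne (Finset.Subset.antisymm hS hcon)
  have hz2 : ∀ z ∈ S, (G.neighborFinset v ∩ G.neighborFinset z).card = 2 := by
    intro z hz
    exact T.c2 _ _ ((G.mem_neighborFinset _ _).1 (hS hz))
  have hle : ∀ z ∈ S, (P.filter (fun p => p.2 = z)).card ≤
      ((G.neighborFinset v ∩ G.neighborFinset z) ∩ S).card := by
    intro z hz
    apply Finset.card_le_card_of_injOn Prod.fst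
    · intro p hp
      simp only [Finset.coe_filter, Set.mem_ofPred_eq] at hp
      obtain ⟨h1, h2, h3⟩ := hP p hp.1
      simp only [Finset.coe_inter, Set.mem_inter_iff, Finset.mem_coe,
        SimpleGraph.mem_neighborFinset]
      refine ⟨⟨(G.mem_neighborFinset _ _).1 (hS h1), ?_⟩, h1⟩
      rw [← hp.2]
      exact h3.symm
    · intro p hp q hq hpq
      simp only [Finset.coe_filter, Set.mem_ofPred_eq] at hp hq
      exact Prod.ext hpq (hp.2.trans hq.2.symm)
  have hsum : P.card = ∑ z ∈ S, (P.filter (fun p => p.2 = z)).card :=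
    Finset.card_eq_sum_card_fiberwise (fun p hp => (hP p hp).2.1)
  have hall : ∀ z ∈ S, G.neighborFinset v ∩ G.neighborFinset z ⊆ S := by
    by_contra hcon
    push Not at hcon
    obtain ⟨z, hz, hzS⟩ := hcon
    have hlt : ∑ z ∈ S, (P.filter (fun p => p.2 = z)).card < ∑ z ∈ S, 2 := by
      apply Finset.sum_lt_sum
      · intro i hi
        refine (hle i hi).trans ((Finset.card_le_card Finset.inter_subset_left).trans ?_)
        rw [hz2 i hi]
      · refine ⟨z, hz, (hle z hz).trans_lt ?_⟩
        rw [← hz2 z hz]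
        apply Finset.card_lt_card
        refine ⟨Finset.inter_subset_left, fun h => hzS (fun w hw => ?_)⟩
        exact (Finset.mem_inter.1 (h hw)).2
    rw [Finset.sum_const, smul_eq_mul] at hlt
    omega
  have hvy : G.Adj v y := (G.mem_neighborFinset _ _).1 hy
  have hdis : Disjoint S (G.neighborFinset v ∩ G.neighborFinset y) := by
    rw [Finset.disjoint_left]
    intro z hz hz'
    apply hyS
    apply hall z hz
    simp only [Finset.mem_inter, SimpleGraph.mem_neighborFinset] at hz' ⊢
    exact ⟨hvy, hz'.2.symm⟩
  have hy2 : y ∉ S ∪ (G.neighborFinset v ∩ G.neighborFinset y) := by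
    simp [hyS]
  have hsub : insert y (S ∪ (G.neighborFinset v ∩ G.neighborFinset y)) ⊆
      G.neighborFinset v := by
    intro w hw
    rw [Finset.mem_insert, Finset.mem_union, Finset.mem_inter] at hw
    rcases hw with rfl | hw | hw
    · exact hy
    · exact hS hw
    · exact hw.1
  have := Finset.card_le_card hsub
  rw [Finset.card_insert_of_notMem hy2, Finset.card_union_of_disjoint hdis, T.c2 _ _ hvy,
    SimpleGraph.card_neighborFinset_eq_degree] at this
  have := T.d6 v
  omega

variable {φ : ℕ → V} {M k : ℕ}

theorem Emb.lt (R : Emb G φ (body M) k) {v j : ℕ} (h : j ∈ bs (row M v)) :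
    v < k ∧ j < k ∧ G.Adj (φ v) (φ j) := by
  rw [mem_row] at h
  exact R.adj _ _ h.1 h.2

theorem Emb.sub (R : Emb G φ (body M) k) (v : ℕ) :
    (bs (row M v)).image φ ⊆ G.neighborFinset (φ v) := by
  intro w hw
  rw [Finset.mem_image] at hw
  obtain ⟨j, hj, rfl⟩ := hw
  rw [SimpleGraph.mem_neighborFinset]
  exact (R.lt hj).2.2

theorem Emb.card_image (R : Emb G φ (body M) k) (s : Finset ℕ) (hs : ∀ i ∈ s, i < k) :
    (s.image φ).card = s.card := by
  apply Finset.card_image_of_injOn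
  intro i hi j hj h
  exact R.inj i (hs i hi) j (hs j hj) h

theorem Emb.deg_ge (R : Emb G φ (body M) k) (v : ℕ) :
    (bs (row M v)).card ≤ G.degree (φ v) := by
  rw [← R.card_image _ (fun i hi => (R.lt hi).2.1), ← SimpleGraph.card_neighborFinset_eq_degree]
  exact Finset.card_le_card (R.sub v)

theorem Emb.full_deg (R : Emb G φ (body M) k) (v : ℕ)
    (h : (bs (row M v)).image φ = G.neighborFinset (φ v)) :
    G.degree (φ v) = (bs (row M v)).card := by
  rw [← SimpleGraph.card_neighborFinset_eq_degree, ← h,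
    R.card_image _ (fun i hi => (R.lt hi).2.1)]

theorem Emb.is6 (T : Tri G N) (R : Emb G φ (body M) k) {v : ℕ} (h : ge6 (row M v) = true) :
    G.degree (φ v) = 6 ∧ (bs (row M v)).image φ = G.neighborFinset (φ v) := by
  rw [ge6_iff] at h
  have h1 := R.deg_ge v
  have h2 := T.d6 (φ v)
  refine ⟨by omega, Finset.eq_of_subset_of_card_le (R.sub v) ?_⟩
  rw [R.card_image _ (fun i hi => (R.lt hi).2.1), SimpleGraph.card_neighborFinset_eq_degree]
  omega

theorem row_lt (M v : ℕ) : row M v < 2 ^ 16 := Nat.mod_lt _ (by norm_num)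

theorem Emb.closed (T : Tri G N) (R : Emb G φ (body M) k) {v : ℕ} (hv : v < 16)
    (h4 : 4 ≤ (bs (row M v)).card)
    (h : 2 * (bs (row M v)).card ≤ (bs (link M v (row M v))).card) :
    (bs (row M v)).image φ = G.neighborFinset (φ v) := by
  have key : ∀ n ∈ bs (link M v (row M v)), n / 16 ∈ bs (row M v) ∧ n % 16 ∈ bs (row M v) ∧
      n / 16 < k ∧ n % 16 < k ∧ G.Adj (φ (n / 16)) (φ (n % 16)) := by
    intro n hn
    rw [mem_bs] at hn
    obtain ⟨h1, h2, h3⟩ := link_bit _ _ _ _ (row_lt M v) hn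
    have hm : n % 16 < 16 := Nat.mod_lt _ (by norm_num)
    have hA := R.adj (n / 16) (n % 16) hm (by rwa [Nat.div_add_mod])
    have hk := R.hk
    refine ⟨?_, (mem_bs _ _).2 h2, hA.1, hA.2.1, hA.2.2⟩
    rw [mem_row]
    exact ⟨by omega, R.sym _ (by omega) _ hv h3⟩
  have hcS := R.card_image (bs (row M v)) (fun i hi => (R.lt hi).2.1)
  apply closed_lemma T (φ v) _ (R.sub v) (by omega)
    ((bs (link M v (row M v))).image (fun n => (φ (n / 16), φ (n % 16))))
  · intro p hp
    rw [Finset.mem_image] at hp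
    obtain ⟨n, hn, rfl⟩ := hp
    obtain ⟨h1, h2, -, -, h3⟩ := key n hn
    exact ⟨Finset.mem_image_of_mem _ h1, Finset.mem_image_of_mem _ h2, h3⟩
  · rw [hcS, Finset.card_image_of_injOn]
    · exact h
    · intro n hn n' hn' he
      obtain ⟨-, -, a1, a2, -⟩ := key n hn
      obtain ⟨-, -, b1, b2, -⟩ := key n' hn'
      simp only [Prod.mk.injEq] at he
      have e1 := R.inj _ a1 _ b1 he.1
      have e2 := R.inj _ a2 _ b2 he.2
      omega

theorem Emb.closedR (T : Tri G N) (R : Emb G φ (body M) k) {v : ℕ} (hv : v < 16)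
    (h : closedR M v (row M v) = true) :
    (bs (row M v)).image φ = G.neighborFinset (φ v) := by
  unfold TriSearch.closedR at h
  rw [rec_iff, rec_iff, andd_iff] at h
  have h7 : (bs (row M v)).card ≤ 6 := (R.deg_ge v).trans (T.d6 _)
  simp only [closed4, closed5, closed6, ge8_iff, ge10_iff, ge12_iff, ge4_iff, ge5_iff, ge6_iff,
    ← Bool.not_eq_true] at h
  exact R.closed T hv (by omega) (by omega)

theorem Emb.is4 (T : Tri G N) (R : Emb G φ (body M) k) {v : ℕ} (hv : v < 16)
    (h : is4 M v = true) : G.degree (φ v) = 4 := by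
  unfold TriSearch.is4 at h
  rw [force_eq, butnot_iff, andd_iff] at h
  simp only [closed4, ge8_iff, ge4_iff, ge5_iff, ← Bool.not_eq_true] at h
  rw [R.full_deg v (R.closed T hv (by omega) (by omega))]
  omega

theorem Emb.nonadj (R : Emb G φ (body M) k) {a c : ℕ} (hc : c < k)
    (hf : (bs (row M a)).image φ = G.neighborFinset (φ a)) (h : tb M a c = false) :
    ¬ G.Adj (φ a) (φ c) := by
  intro hadj
  rw [← SimpleGraph.mem_neighborFinset, ← hf, Finset.mem_image] at hadj
  obtain ⟨j, hj, he⟩ := hadj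
  have := R.inj _ (R.lt hj).2.1 _ hc he
  subst this
  rw [mem_row, ← tb_iff, h] at hj
  simp at hj

theorem Emb.badLocal (T : Tri G N) (R : Emb G φ (body M) k) {a b x : ℕ}
    (hab : G.Adj (φ a) (φ b)) (hax : G.Adj (φ a) (φ x)) (hbx : G.Adj (φ b) (φ x)) :
    ¬ badLocal M a b x = true := by
  have hcm : ∀ u v, G.Adj (φ u) (φ v) → ¬ ge3 (cm M u v) = true := by
    intro u v huv h
    rw [ge3_iff] at h
    have h2 : (bs (cm M u v)).image φ ⊆ G.neighborFinset (φ u) ∩ G.neighborFinset (φ v) := by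
      intro w hw
      rw [Finset.mem_image] at hw
      obtain ⟨j, hj, rfl⟩ := hw
      rw [mem_cm] at hj
      rw [Finset.mem_inter, SimpleGraph.mem_neighborFinset, SimpleGraph.mem_neighborFinset]
      exact ⟨(R.lt hj.1).2.2, (R.lt hj.2).2.2⟩
    have h3 := Finset.card_le_card h2
    rw [T.c2 _ _ huv, R.card_image _ (fun i hi => (R.lt ((mem_cm _ _ _ _).1 hi).1).2.1)] at h3
    omega
  have h7 : ∀ u, ¬ ge7 (row M u) = true := by
    intro u h
    rw [ge7_iff] at h
    have := R.deg_ge u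
    have := T.d6 (φ u)
    omega
  unfold TriSearch.badLocal
  simp only [orr_iff]
  rintro (h | h | h | h | h | h)
  · exact hcm _ _ hax h
  · exact hcm _ _ hbx h
  · rw [ge1_iff] at h
    obtain ⟨j, hj⟩ := Finset.card_pos.1 h
    rw [mem_bs, show Nat.land (cm M a b) (row M x) = cm M a b &&& row M x from rfl,
      Nat.testBit_land, Bool.and_eq_true, ← mem_bs, ← mem_bs, mem_cm] at hj
    exact T.k4 _ _ _ _ hab hax (R.lt hj.1.1).2.2 hbx (R.lt hj.1.2).2.2 (R.lt hj.2).2.2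
  · exact h7 _ h
  · exact h7 _ h
  · exact h7 _ h

theorem Emb.rootBad (T : Tri G N) (R : Emb G φ (body M) k) {r : ℕ} (hr : r = 4 ∨ r = 6)
    (h0 : G.degree (φ 0) = r) : ¬ rootBad r M = true := by
  unfold TriSearch.rootBad
  rw [force_eq, rec_iff, butnot_iff]
  rintro (⟨h1, h2⟩ | ⟨h1, h2, h3⟩)
  · rw [Nat.beq_eq] at h1
    rw [ge5_iff] at h2
    have := R.deg_ge 0
    omega
  · have h1' : r ≠ 4 := by
      rintro rfl
      cases h1
    have := R.full_deg 0 (R.closedR T (by norm_num) h3)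
    rw [← Bool.not_eq_true, ge6_iff] at h2
    omega

theorem sep_iff (M a c : ℕ) (t : Bool) :
    sep M a c t = true ↔ a ≠ c ∧ tb M a c = false ∧ t = true := by
  unfold sep
  rw [butnot_iff, butnot_iff, ← Bool.not_eq_true, Nat.beq_eq]

theorem Emb.cover_eq (T : Tri G N) (R : Emb G φ (body M) k) {a b c : ℕ} (ha : a < k) (hb : b < k)
    (hc : c < k) (hN : N = 15)
    (fa : (bs (row M a)).image φ = G.neighborFinset (φ a))
    (fb : (bs (row M b)).image φ = G.neighborFinset (φ b))
    (fc : (bs (row M c)).image φ = G.neighborFinset (φ c))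
    (h : ∀ v : V, v ≠ φ a → v ≠ φ b → v ≠ φ c → G.Adj v (φ a) ∨ G.Adj v (φ b) ∨ G.Adj v (φ c)) :
    cover M a b c = 32767 := by
  have hmem : ∀ i, i ∈ bs (cover M a b c) ↔ i ∈ bs (row M a) ∨ i ∈ bs (row M b) ∨
      i ∈ bs (row M c) ∨ i = a ∨ i = b ∨ i = c := by
    intro i
    have : cover M a b c = ((row M a ||| row M b) ||| row M c) |||
      ((2 ^ a ||| 2 ^ b) ||| 2 ^ c) := rfl
    simp only [mem_bs, this, Nat.testBit_or, Nat.testBit_two_pow, Bool.or_eq_true,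
      decide_eq_true_eq, or_assoc, @eq_comm ℕ i a, @eq_comm ℕ i b, @eq_comm ℕ i c]
  have hlt : ∀ i ∈ bs (cover M a b c), i < k := by
    intro i hi
    rw [hmem] at hi
    rcases hi with hi | hi | hi | rfl | rfl | rfl
    · exact (R.lt hi).2.1
    · exact (R.lt hi).2.1
    · exact (R.lt hi).2.1
    all_goals assumption
  have hk : k ≤ 15 := by
    have h1 := R.card_image (Finset.range k) (fun i hi => Finset.mem_range.1 hi)
    rw [Finset.card_range] at h1
    have h2 := Finset.card_le_univ ((Finset.range k).image φ)
    rw [T.card] at h2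
    omega
  have hcard : 15 ≤ (bs (cover M a b c)).card := by
    rw [← hN, ← T.card, ← Finset.card_univ]
    refine (Finset.card_le_card ?_).trans (Finset.card_image_le (s := bs (cover M a b c)) (f := φ))
    intro v _
    rw [Finset.mem_image]
    have aux : ∀ u, (bs (row M u)).image φ = G.neighborFinset (φ u) → G.Adj v (φ u) →
        ∃ j ∈ bs (row M u), φ j = v := by
      intro u hu hv
      rw [← Finset.mem_image, hu, SimpleGraph.mem_neighborFinset]
      exact hv.symm
    by_cases va : v = φ a
    · exact ⟨a, (hmem a).2 (by simp), va.symm⟩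
    by_cases vb : v = φ b
    · exact ⟨b, (hmem b).2 (by simp), vb.symm⟩
    by_cases vc : v = φ c
    · exact ⟨c, (hmem c).2 (by simp), vc.symm⟩
    rcases h v va vb vc with hv | hv | hv
    · obtain ⟨j, hj, e⟩ := aux _ fa hv
      exact ⟨j, (hmem j).2 (by simp [hj]), e⟩
    · obtain ⟨j, hj, e⟩ := aux _ fb hv
      exact ⟨j, (hmem j).2 (by simp [hj]), e⟩
    · obtain ⟨j, hj, e⟩ := aux _ fc hv
      exact ⟨j, (hmem j).2 (by simp [hj]), e⟩
  have heq : bs (cover M a b c) = Finset.range 15 := by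
    apply Finset.eq_of_subset_of_card_le
    · intro i hi
      have := hlt i hi
      rw [Finset.mem_range]
      omega
    · simpa using hcard
  apply Nat.eq_of_testBit_eq
  intro i
  rw [show (32767 : ℕ) = 2 ^ 15 - 1 by norm_num, Nat.testBit_two_pow_sub_one, Bool.eq_iff_iff,
    ← mem_bs, heq]
  simp

theorem Emb.pat (T : Tri G N) (R : Emb G φ (body M) k) {m : ℕ} {l4 l6 : List ℕ}
    (hm : m = 0 → ∀ v, G.degree v ≠ 4) (hnd : l4.Nodup)
    (h4 : ∀ i ∈ l4, i < k ∧ G.degree (φ i) = 4)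
    (h6 : ∀ i ∈ l6, i < k ∧ G.degree (φ i) = 6 ∧
      (bs (row M i)).image φ = G.neighborFinset (φ i)) :
    ¬ pat N m M l4 l6 = true := by
  have hne : ∀ i < k, ∀ j < k, i ≠ j → φ i ≠ φ j := fun i hi j hj h e => h (R.inj i hi j hj e)
  unfold TriSearch.pat
  simp only [orr_iff]
  rintro (h | h | h | h)
  · match l4, hnd, h4, h with
    | [], _, _, h => simp at h
    | [_], _, _, h => simp at h
    | [_, _], _, _, h => simp at h
    | a :: b :: c :: t, hnd, h4, _ =>
      simp only [List.nodup_cons, List.mem_cons, not_or] at hnd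
      have ha := h4 a (by simp)
      have hb := h4 b (by simp)
      have hc := h4 c (by simp)
      exact T.n4 _ _ _ (hne a ha.1 b hb.1 hnd.1.1) (hne a ha.1 c hc.1 hnd.1.2.1)
        (hne b hb.1 c hc.1 hnd.2.1.1) ha.2 hb.2 hc.2
  · match l4, h4, h with
    | [], _, h => simp at h
    | a :: t, h4, h =>
      exact hm (Nat.eq_of_beq_eq_true h) _ (h4 a (by simp)).2
  · simp only [anyL_iff] at h
    obtain ⟨a, ha, b, hb, h⟩ := h
    have hka := (h4 a ha).1
    have hkb := (h4 b hb).1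
    have := R.hk
    rw [tb_iff] at h
    exact T.h44 _ _ (R.adj _ _ (by omega) h).2.2 ⟨(h4 a ha).2, (h4 b hb).2⟩
  · simp only [anyL_iff] at h
    obtain ⟨a, ha, b, hb, h⟩ := h
    obtain ⟨ka, da, fa⟩ := h6 a ha
    obtain ⟨kb, db, fb⟩ := h6 b hb
    have hk := R.hk
    rw [rec_iff, rec_iff] at h
    rcases h with ⟨hab, h⟩ | ⟨hab, ⟨_, h⟩ | ⟨hneq, h⟩⟩
    · unfold patAdj at h
      simp only [anyL_iff, sep_iff] at h
      obtain ⟨c, hc, hac, tac, hbc, tbc, h⟩ := h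
      obtain ⟨kc, dc, fc⟩ := h6 c hc
      rw [tb_iff] at hab
      obtain ⟨h15, hall⟩ := T.h518 (φ a) (φ b) (φ c) (R.adj _ _ (by omega) hab).2.2 da db dc
        (hne _ kc _ ka hac.symm) (hne _ kc _ kb hbc.symm)
        (fun e => R.nonadj kc fa tac e.symm) (fun e => R.nonadj kc fb tbc e.symm)
      rw [R.cover_eq T ka kb kc h15 fa fb fc hall, h15] at h
      exact absurd h (by decide)
    · cases h
    · unfold pat66 at h
      rw [← Bool.not_eq_true, Nat.beq_eq] at hneq
      have nab := R.nonadj kb fa hab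
      simp only [orr_iff, anyL_iff, sep_iff, Nat.beq_eq] at h
      rcases h with h | ⟨c, hc, hac, tac, hbc, tbc, -⟩ | ⟨c, hc, hac, tac, hbc, tbc, -⟩
      · exact T.h66 _ _ (hne _ ka _ kb hneq) nab da db h
      · obtain ⟨kc, dc, fc⟩ := h6 c hc
        exact T.h666 _ _ _ (hne _ ka _ kb hneq) (hne _ ka _ kc hac) (hne _ kb _ kc hbc)
          nab (R.nonadj kc fa tac) (R.nonadj kc fb tbc) da db dc
      · obtain ⟨kc, dc⟩ := h4 c hc
        exact T.h664 _ _ _ (hne _ ka _ kb hneq) (hne _ ka _ kc hac) (hne _ kb _ kc hbc)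
          nab (R.nonadj kc fa tac) (R.nonadj kc fb tbc) da db dc

theorem Emb.k_le (T : Tri G N) (R : Emb G φ (body M) k) : k ≤ N := by
  have h1 := R.card_image (Finset.range k) (fun i hi => Finset.mem_range.1 hi)
  rw [Finset.card_range] at h1
  have h2 := Finset.card_le_univ ((Finset.range k).image φ)
  rw [T.card] at h2
  omega

theorem Emb.bad (T : Tri G N) (R : Emb G φ (body M) k) {m r : ℕ} (hr : r = 4 ∨ r = 6)
    (h0 : G.degree (φ 0) = r) (hm : m = 0 → ∀ v, G.degree v ≠ 4) :
    ¬ bad N m r M k = true := by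
  unfold TriSearch.bad
  simp only [orr_iff, withList_eq]
  have hk := R.hk
  rintro (h | h | h)
  · have := R.k_le T
    have h' : Nat.ble (N + 1) k = true := h
    rw [Nat.ble_eq] at h'
    omega
  · exact R.rootBad T hr h0 h
  · refine R.pat T hm ?_ ?_ ?_ h
    · simpa using List.Nodup.filter _ List.nodup_range
    · intro i hi
      simp only [List.append_nil, List.mem_filter, List.mem_range] at hi
      exact ⟨hi.1, R.is4 T (by omega) hi.2⟩
    · intro i hi
      simp only [List.append_nil, List.mem_filter, List.mem_range] at hi
      exact ⟨hi.1, R.is6 T hi.2⟩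

end graph

section search

set_option linter.unusedSectionVars false

variable {V : Type*} [Fintype V] [DecidableEq V] {G : SimpleGraph V} [DecidableRel G.Adj] {N : ℕ}

/-- The graph is the target. -/
def Good (G : SimpleGraph V) (N : ℕ) : Prop :=
  N = 14 ∧ ∃ φ : ℕ → V, (∀ i < 14, ∀ j < 14, φ i = φ j → i = j) ∧
    ∀ i < 14, ∀ j < 14, (G.Adj (φ i) (φ j) ↔ target.testBit (16 * i + j) = true)

theorem findB_some {M a n b : ℕ} (h : findB M a n = some b) :
    b < n ∧ tb M a b = true ∧ ge2 (cm M a b) = false := by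
  induction n with
  | zero => cases h
  | succ n ih =>
    have e : findB M a (n + 1) = (Bool.rec (findB M a n)
      (Bool.rec (some n) (findB M a n) (ge2 (cm M a n)) : Option ℕ) (tb M a n) : Option ℕ) := rfl
    rw [e] at h
    cases h1 : tb M a n with
    | false =>
      rw [h1] at h
      have := ih h
      exact ⟨by omega, this.2⟩
    | true =>
      cases h2 : ge2 (cm M a n) with
      | true =>
        rw [h1, h2] at h
        have := ih h
        exact ⟨by omega, this.2⟩
      | false =>
        rw [h1, h2] at h
        cases h
        exact ⟨by omega, h1, h2⟩

theorem findOpen_some {M f s : ℕ} {p : ℕ × ℕ} (h : findOpen M f s = some p) :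
    p.2 < 15 ∧ tb M p.1 p.2 = true ∧ ge2 (cm M p.1 p.2) = false := by
  induction f generalizing s with
  | zero => cases h
  | succ f ih =>
    have e : findOpen M (f + 1) s = (Option.rec (findOpen M f (s + 1)) (fun b => some (s, b))
      (findB M s 15) : Option (ℕ × ℕ)) := rfl
    rw [e] at h
    cases hb : findB M s 15 with
    | none =>
      rw [hb] at h
      exact ih h
    | some b =>
      rw [hb] at h
      cases h
      exact findB_some hb

variable {φ : ℕ → V} {M k : ℕ}

theorem Emb.leaf (T : Tri G N) (R : Emb G φ (body M) k) (h : leaf N M k = true) :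
    Good G N := by
  unfold TriSearch.leaf at h
  simp only [andd_iff, orr_iff, allLt_iff, force_eq, Nat.beq_eq] at h
  obtain ⟨hcl, h⟩ := h
  have hk := R.hk
  have hfull : ∀ v < k, (bs (row M v)).image φ = G.neighborFinset (φ v) :=
    fun v hv => R.closedR T (by omega) (hcl v hv)
  rcases h with ⟨h1, h2⟩ | ⟨h1, h2, h3⟩
  · exfalso
    have h1' : Nat.ble (k + 1) N = true := h1
    have h2' : N ≤ k + 5 := by
      have : Nat.ble N (k + 5) = true := h2
      rwa [Nat.ble_eq] at this
    rw [Nat.ble_eq] at h1'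
    set C : Finset V := Finset.univ \ (Finset.range k).image φ with hC
    have hcard : C.card = N - k := by
      rw [hC, Finset.card_sdiff_of_subset (Finset.subset_univ _), Finset.card_univ, T.card,
        R.card_image _ (fun i hi => Finset.mem_range.1 hi), Finset.card_range]
    have hmem : ∀ v, v ∈ C ↔ ∀ i < k, φ i ≠ v := by
      intro v
      simp [hC]
    have hnb : ∀ u ∈ C, ∀ w, G.Adj u w → w ∈ C := by
      intro u hu w huw
      rw [hmem] at hu ⊢
      rintro i hi rfl
      have : u ∈ G.neighborFinset (φ i) := by
        rw [SimpleGraph.mem_neighborFinset]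
        exact huw.symm
      rw [← hfull i hi, Finset.mem_image] at this
      obtain ⟨j, hj, e⟩ := this
      exact hu j (R.lt hj).2.1 e
    have hdeg : ∀ u ∈ C, G.degree u + 1 ≤ C.card := by
      intro u hu
      rw [← SimpleGraph.card_neighborFinset_eq_degree, ← Finset.card_insert_of_notMem
        (G.notMem_neighborFinset_self u)]
      apply Finset.card_le_card
      intro w hw
      rw [Finset.mem_insert, SimpleGraph.mem_neighborFinset] at hw
      rcases hw with rfl | hw
      · exact hu
      · exact hnb u hu w hw
    obtain ⟨u, hu⟩ : C.Nonempty := Finset.card_pos.1 (by omega)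
    have hu1 := hdeg u hu
    have hu4 := T.d4 u
    have hpos : 0 < (G.neighborFinset u).card := by
      rw [SimpleGraph.card_neighborFinset_eq_degree]
      omega
    obtain ⟨w, hw⟩ := Finset.card_pos.1 hpos
    rw [SimpleGraph.mem_neighborFinset] at hw
    have hw1 := hdeg w (hnb u hu w hw)
    have hw4 := T.d4 w
    exact T.h44 u w hw ⟨by omega, by omega⟩
  · subst h2
    refine ⟨h1, φ, R.inj, fun i hi j hj => ⟨fun hadj => ?_, fun hb => ?_⟩⟩
    · rw [← SimpleGraph.mem_neighborFinset, ← hfull i hi, Finset.mem_image] at hadj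
      obtain ⟨j', hj', e⟩ := hadj
      have := R.inj _ (R.lt hj').2.1 _ hj e
      subst this
      rw [mem_row, h3] at hj'
      exact hj'.2
    · rw [← h3] at hb
      exact (R.adj i j (by omega) hb).2.2

/-- Adding an edge to a realised matrix. -/
theorem Emb.addE {Y : ℕ} (R : Emb G φ Y k) {a x : ℕ} (ha : a < k) (hx : x < k)
    (h : G.Adj (φ a) (φ x)) : Emb G φ (addE Y a x) k := by
  have hk := R.hk
  refine ⟨R.hk, R.inj, fun i hi j hj hb => ?_, fun i j hj hb => ?_⟩
  · rw [addE_testBit] at hb ⊢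
    rcases hb with hb | hb | hb
    · exact Or.inl (R.sym i hi j hj hb)
    · right; right; omega
    · right; left; omega
  · rw [addE_testBit] at hb
    rcases hb with hb | hb | hb
    · exact R.adj i j hj hb
    · obtain ⟨rfl, rfl⟩ : i = a ∧ j = x := by omega
      exact ⟨ha, hx, h⟩
    · obtain ⟨rfl, rfl⟩ : i = x ∧ j = a := by omega
      exact ⟨hx, ha, h.symm⟩

/-- Adding a label. -/
theorem Emb.new {Y : ℕ} (R : Emb G φ Y k) (hk : k < 16) {y : V} (hy : ∀ i < k, φ i ≠ y) :
    Emb G (Function.update φ k y) Y (k + 1) := by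
  have hup : ∀ i < k, Function.update φ k y i = φ i := fun i hi =>
    Function.update_of_ne (by omega) _ _
  refine ⟨by omega, fun i hi j hj he => ?_, R.sym, fun i j hj hb => ?_⟩
  · rcases Nat.lt_succ_iff_lt_or_eq.1 hi with hi | rfl
    · rcases Nat.lt_succ_iff_lt_or_eq.1 hj with hj | rfl
      · rw [hup i hi, hup j hj] at he
        exact R.inj i hi j hj he
      · rw [hup i hi, Function.update_self] at he
        exact absurd he (hy i hi)
    · rcases Nat.lt_succ_iff_lt_or_eq.1 hj with hj | rfl
      · rw [hup j hj, Function.update_self] at he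
        exact absurd he.symm (hy j hj)
      · rfl
  · obtain ⟨h1, h2, h3⟩ := R.adj i j hj hb
    rw [hup i h1, hup j h2]
    exact ⟨by omega, by omega, h3⟩

theorem go_sound (T : Tri G N) {m r : ℕ} (hr : r = 4 ∨ r = 6)
    (hm : m = 0 → ∀ v, G.degree v ≠ 4) (f : ℕ) : ∀ (M k s : ℕ) (φ : ℕ → V),
    Emb G φ (body M) k → 0 < k → G.degree (φ 0) = r → go N m r f M k s = true → Good G N := by
  induction f with
  | zero => intro M k s φ _ _ _ h; cases h
  | succ f ih =>
    intro M k s φ R hk0 h0 h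
    have hk15 : k ≤ 15 := (R.k_le T).trans T.hN
    have e : go N m r (f + 1) M k s = (Option.rec (leaf N M k)
      (fun p => force p.1 (fun a => force p.2 (fun b => allLt (Nat.succ k) (fun x =>
        orr (Nat.beq x a) (orr (Nat.beq x b) (orr (andd (tb M a x) (tb M b x))
        (force (stamp (TriSearch.addE (TriSearch.addE (body M) a x) b x)) (fun M' =>
          orr (badLocal M' a b x)
          (force (newK k x) (fun k' => orr (bad N m r M' k') (go N m r f M' k' a)))))))))))
      (findOpen M (Nat.sub k s) s) : Bool) := rfl
    rw [e] at h
    cases ho : findOpen M (Nat.sub k s) s with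
    | none =>
      rw [ho] at h
      exact R.leaf T h
    | some p =>
      rw [ho] at h
      obtain ⟨a, b⟩ := p
      obtain ⟨hb15, hab, hcm⟩ := findOpen_some ho
      simp only at hb15 hab hcm
      simp only [force_eq, allLt_iff, orr_iff, andd_iff, Nat.beq_eq] at h
      rw [tb_iff] at hab
      obtain ⟨ha, hb, hadj⟩ := R.adj a b (by omega) hab
      -- the missing common neighbour
      have hsub : (bs (cm M a b)).image φ ⊆ G.neighborFinset (φ a) ∩ G.neighborFinset (φ b) := by
        intro w hw
        rw [Finset.mem_image] at hw
        obtain ⟨j, hj, rfl⟩ := hw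
        rw [mem_cm] at hj
        rw [Finset.mem_inter, SimpleGraph.mem_neighborFinset, SimpleGraph.mem_neighborFinset]
        exact ⟨(R.lt hj.1).2.2, (R.lt hj.2).2.2⟩
      obtain ⟨y, hy, hyn⟩ : ∃ y ∈ G.neighborFinset (φ a) ∩ G.neighborFinset (φ b),
          y ∉ (bs (cm M a b)).image φ := by
        by_contra hcon
        push Not at hcon
        have h1 := Finset.card_le_card hcon
        rw [T.c2 _ _ hadj] at h1
        have h2 := h1.trans Finset.card_image_le
        rw [← ge2_iff, hcm] at h2
        cases h2
      rw [Finset.mem_inter, SimpleGraph.mem_neighborFinset, SimpleGraph.mem_neighborFinset] at hy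
      obtain ⟨hay, hby⟩ := hy
      have main : ∀ (x : ℕ) (ψ : ℕ → V), x < k + 1 → Emb G ψ (body M) (newK k x) →
          x < newK k x → k ≤ newK k x → (∀ i < k, ψ i = φ i) → ψ x = y →
          ¬ (tb M a x = true ∧ tb M b x = true) → Good G N := by
        intro x ψ hx Rψ hxk hkk hψ hψx hnot
        have hψa := hψ a ha
        have hψb := hψ b hb
        have hax : G.Adj (ψ a) (ψ x) := by rw [hψa, hψx]; exact hay
        have hbx : G.Adj (ψ b) (ψ x) := by rw [hψb, hψx]; exact hby
        have habψ : G.Adj (ψ a) (ψ b) := by rw [hψa, hψb]; exact hadj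
        have R2 := (Rψ.addE (a := a) (x := x) (by omega) hxk hax).addE (a := b) (x := x)
          (by omega) hxk hbx
        rw [← body_stamp (TriSearch.addE (TriSearch.addE (body M) a x) b x)] at R2
        have h0ψ : G.degree (ψ 0) = r := by rw [hψ 0 hk0]; exact h0
        rcases h x hx with h | h | h | h | h | h
        · subst h; exact absurd hax (G.loopless.irrefl _)
        · subst h; exact absurd hbx (G.loopless.irrefl _)
        · exact absurd h hnot
        · exact absurd h (R2.badLocal T habψ hax hbx)
        · exact absurd h (R2.bad T hr h0ψ hm)
        · exact ih _ _ _ ψ R2 (by omega) h0ψ h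
      by_cases hold : ∃ x < k, φ x = y
      · obtain ⟨x, hx, rfl⟩ := hold
        have hnk : newK k x = k := by
          unfold newK
          rw [show Nat.beq x k = false by
            rw [← Bool.not_eq_true, Nat.beq_eq]; omega]
        refine main x φ (by omega) (by rwa [hnk]) (by omega) (by omega) (fun _ _ => rfl) rfl ?_
        rintro ⟨h1, h2⟩
        apply hyn
        apply Finset.mem_image_of_mem
        rw [tb_iff] at h1 h2
        rw [mem_cm, mem_row, mem_row]
        exact ⟨⟨by omega, h1⟩, ⟨by omega, h2⟩⟩
      · push Not at hold
        have hnk : newK k k = k + 1 := by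
          unfold newK
          rw [show Nat.beq k k = true by rw [Nat.beq_eq]]
        refine main k (Function.update φ k y) (by omega) ?_ (by omega) (by omega)
          (fun i hi => Function.update_of_ne (by omega) _ _) (Function.update_self _ _ _) ?_
        · rw [hnk]
          exact R.new (by omega) hold
        · rintro ⟨h1, _⟩
          rw [tb_iff] at h1
          have := (R.adj a k (by omega) h1).2.1
          omega

theorem start_emb (u v : V) (h : G.Adj u v) :
    Emb G (fun i => if i = 0 then u else v) (body start) 2 := by
  have hb : ∀ n, (body start).testBit n = true ↔ n = 1 ∨ n = 16 := by
    intro n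
    have : body start = 2 ^ 1 ||| 2 ^ 16 := by decide
    rw [this, Nat.testBit_or, Nat.testBit_two_pow, Nat.testBit_two_pow]
    simp only [Bool.or_eq_true, decide_eq_true_eq]
    omega
  refine ⟨by norm_num, fun i hi j hj he => ?_, fun i hi j hj hbit => ?_, fun i j hj hbit => ?_⟩
  · have hne := h.ne
    interval_cases i <;> interval_cases j <;> simp_all
  · rw [hb] at hbit ⊢
    omega
  · rw [hb] at hbit
    rcases hbit with hbit | hbit
    · obtain ⟨rfl, rfl⟩ : i = 0 ∧ j = 1 := by omega
      simpa using h
    · obtain ⟨rfl, rfl⟩ : i = 1 ∧ j = 0 := by omega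
      simpa using h.symm

theorem run_13_6 : go 13 0 6 60 start 2 0 = true := by decide +kernel
theorem run_14_6 : go 14 0 6 60 start 2 0 = true := by decide +kernel
theorem run_15_6 : go 15 0 6 60 start 2 0 = true := by decide +kernel
theorem run_13_4 : go 13 2 4 60 start 2 0 = true := by decide +kernel
theorem run_14_4 : go 14 2 4 60 start 2 0 = true := by decide +kernel
theorem run_15_4 : go 15 2 4 60 start 2 0 = true := by decide +kernel

theorem search_good (T : Tri G N) (h13 : 13 ≤ N)
    (hex : (∃ v, G.degree v = 4) ∨ ((∀ v, G.degree v ≠ 4) ∧ ∃ v, G.degree v = 6)) :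
    Good G N := by
  have hnb : ∀ v, ∃ w, G.Adj v w := by
    intro v
    have hpos : 0 < (G.neighborFinset v).card := by
      rw [SimpleGraph.card_neighborFinset_eq_degree]
      have := T.d4 v
      omega
    obtain ⟨w, hw⟩ := Finset.card_pos.1 hpos
    exact ⟨w, (G.mem_neighborFinset _ _).1 hw⟩
  have hN := T.hN
  rcases hex with ⟨v, hv⟩ | ⟨hno, v, hv⟩
  · obtain ⟨w, hw⟩ := hnb v
    have hgo : go N 2 4 60 start 2 0 = true := by
      interval_cases N
      · exact run_13_4
      · exact run_14_4
      · exact run_15_4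
    exact go_sound T (Or.inl rfl) (by simp) 60 start 2 0 _ (start_emb v w hw) (by norm_num)
      (by simpa using hv) hgo
  · obtain ⟨w, hw⟩ := hnb v
    have hgo : go N 0 6 60 start 2 0 = true := by
      interval_cases N
      · exact run_13_6
      · exact run_14_6
      · exact run_15_6
    exact go_sound T (Or.inr rfl) (fun _ => hno) 60 start 2 0 _ (start_emb v w hw) (by norm_num)
      (by simpa using hv) hgo

end search

section final

set_option linter.unusedSectionVars false

variable {V : Type*} [Fintype V] [DecidableEq V] {G : SimpleGraph V} [DecidableRel G.Adj]

theorem common_two (faces : Finset (Finset V))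
    (hface3 : ∀ f ∈ faces, f.card = 3)
    (hfaceclique : ∀ f ∈ faces, ∀ x ∈ f, ∀ y ∈ f, x ≠ y → G.Adj x y)
    (hedge2 : ∀ x y : V, G.Adj x y →
      (faces.filter (fun f => x ∈ f ∧ y ∈ f)).card = 2)
    (htri : ∀ x y z : V, x ≠ y → y ≠ z → x ≠ z →
      G.Adj x y → G.Adj y z → G.Adj x z → ({x, y, z} : Finset V) ∈ faces)
    (x y : V) (hxy : G.Adj x y) :
    (G.neighborFinset x ∩ G.neighborFinset y).card = 2 := by
  rw [← hedge2 x y hxy]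
  apply Finset.card_bij (fun z _ => ({x, y, z} : Finset V))
  · intro z hz
    simp only [Finset.mem_inter, SimpleGraph.mem_neighborFinset] at hz
    rw [Finset.mem_filter]
    exact ⟨htri x y z hxy.ne hz.2.ne hz.1.ne hxy hz.2 hz.1, by simp, by simp⟩
  · intro z hz w hw he
    simp only [Finset.mem_inter, SimpleGraph.mem_neighborFinset] at hz hw
    have : z ∈ ({x, y, w} : Finset V) := by rw [← he]; simp
    simp only [Finset.mem_insert, Finset.mem_singleton] at this
    rcases this with h | h | h
    · exact absurd h hz.1.ne'
    · exact absurd h hz.2.ne'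
    · exact h
  · intro f hf
    rw [Finset.mem_filter] at hf
    obtain ⟨hf, hx, hy⟩ := hf
    have hc : ((f.erase x).erase y).card = 1 := by
      rw [Finset.card_erase_of_mem (Finset.mem_erase.2 ⟨hxy.ne', hy⟩),
        Finset.card_erase_of_mem hx, hface3 f hf]
    obtain ⟨z, hz⟩ := Finset.card_eq_one.1 hc
    have hzm : z ∈ (f.erase x).erase y := by rw [hz]; simp
    rw [Finset.mem_erase, Finset.mem_erase] at hzm
    refine ⟨z, ?_, ?_⟩
    · simp only [Finset.mem_inter, SimpleGraph.mem_neighborFinset]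
      exact ⟨hfaceclique f hf x hx z hzm.2.2 hzm.2.1.symm,
        hfaceclique f hf y hy z hzm.2.2 hzm.1.symm⟩
    · rw [← hz, Finset.insert_erase (Finset.mem_erase.2 ⟨hxy.ne', hy⟩), Finset.insert_erase hx]

/-- In a tetrahedron, every vertex has three further neighbours, not joined to the others. -/
theorem k4_extra
    (c2 : ∀ x y, G.Adj x y → (G.neighborFinset x ∩ G.neighborFinset y).card = 2)
    (d4 : ∀ v, 4 ≤ G.degree v) (a b c d : V)
    (ab : G.Adj a b) (ac : G.Adj a c) (ad : G.Adj a d)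
    (bc : G.Adj b c) (bd : G.Adj b d) (cd : G.Adj c d) :
    ∃ P : Finset V, P.card = 3 ∧
      ∀ y ∈ P, G.Adj a y ∧ ¬G.Adj b y ∧ ¬G.Adj c y ∧ ¬G.Adj d y := by
  have key : ∀ u v w, G.Adj a u → G.Adj a v → G.Adj a w → G.Adj u v → G.Adj u w → v ≠ w →
      ∀ y, G.Adj a y → G.Adj u y → y = v ∨ y = w := by
    intro u v w au av aw uv uw vw y ay uy
    have hsub : ({v, w} : Finset V) ⊆ G.neighborFinset a ∩ G.neighborFinset u := by
      intro z hz
      simp only [Finset.mem_insert, Finset.mem_singleton] at hz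
      simp only [Finset.mem_inter, SimpleGraph.mem_neighborFinset]
      rcases hz with rfl | rfl
      · exact ⟨av, uv⟩
      · exact ⟨aw, uw⟩
    have heq := Finset.eq_of_subset_of_card_le hsub
      (by rw [c2 a u au, Finset.card_pair vw])
    have : y ∈ G.neighborFinset a ∩ G.neighborFinset u := by
      simp only [Finset.mem_inter, SimpleGraph.mem_neighborFinset]
      exact ⟨ay, uy⟩
    rw [← heq] at this
    simpa using this
  have kb := key b c d ab ac ad bc bd cd.ne
  have kc := key c b d ac ab ad bc.symm cd bd.ne
  have kd := key d b c ad ab ac bd.symm cd.symm bc.ne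
  obtain ⟨y, hy, hyn⟩ : ∃ y ∈ G.neighborFinset a, y ∉ ({b, c, d} : Finset V) := by
    by_contra hcon
    push Not at hcon
    have h1 := Finset.card_le_card hcon
    rw [SimpleGraph.card_neighborFinset_eq_degree] at h1
    have h2 := d4 a
    have h3 : ({b, c, d} : Finset V).card ≤ 3 := Finset.card_le_three
    omega
  rw [SimpleGraph.mem_neighborFinset] at hy
  simp only [Finset.mem_insert, Finset.mem_singleton, not_or] at hyn
  have nb : ∀ z, G.Adj a z → z ≠ b → z ≠ c → z ≠ d →
      G.Adj a z ∧ ¬G.Adj b z ∧ ¬G.Adj c z ∧ ¬G.Adj d z := by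
    intro z az zb zc zd
    refine ⟨az, fun h => ?_, fun h => ?_, fun h => ?_⟩
    · rcases kb z az h with h | h
      exacts [zc h, zd h]
    · rcases kc z az h with h | h
      exacts [zb h, zd h]
    · rcases kd z az h with h | h
      exacts [zb h, zc h]
  have hyy := nb y hy hyn.1 hyn.2.1 hyn.2.2
  refine ⟨insert y (G.neighborFinset a ∩ G.neighborFinset y), ?_, ?_⟩
  · rw [Finset.card_insert_of_notMem (by simp), c2 a y hy]
  · intro z hz
    simp only [Finset.mem_insert, Finset.mem_inter, SimpleGraph.mem_neighborFinset] at hz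
    rcases hz with rfl | ⟨az, yz⟩
    · exact hyy
    · refine nb z az ?_ ?_ ?_
      · rintro rfl; exact hyy.2.1 yz.symm
      · rintro rfl; exact hyy.2.2.1 yz.symm
      · rintro rfl; exact hyy.2.2.2 yz.symm

theorem no_k4
    (c2 : ∀ x y, G.Adj x y → (G.neighborFinset x ∩ G.neighborFinset y).card = 2)
    (d4 : ∀ v, 4 ≤ G.degree v) (hN : Fintype.card V ≤ 15) (a b c d : V)
    (ab : G.Adj a b) (ac : G.Adj a c) (ad : G.Adj a d)
    (bc : G.Adj b c) (bd : G.Adj b d) (cd : G.Adj c d) : False := by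
  obtain ⟨A, hA, pA⟩ := k4_extra c2 d4 a b c d ab ac ad bc bd cd
  obtain ⟨B, hB, pB⟩ := k4_extra c2 d4 b a c d ab.symm bc bd ac ad cd
  obtain ⟨C, hC, pC⟩ := k4_extra c2 d4 c a b d ac.symm bc.symm cd ab ad bd
  obtain ⟨D, hD, pD⟩ := k4_extra c2 d4 d a b c ad.symm bd.symm cd.symm ab ac bc
  have hQ : ({a, b, c, d} : Finset V).card = 4 := by
    rw [Finset.card_insert_of_notMem, Finset.card_insert_of_notMem, Finset.card_pair cd.ne]
    · simp [bc.ne, bd.ne]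
    · simp [ab.ne, ac.ne, ad.ne]
  have d1 : Disjoint A B := by
    rw [Finset.disjoint_left]
    intro y h1 h2
    exact (pA y h1).2.1 (pB y h2).1
  have d2 : Disjoint (A ∪ B) C := by
    rw [Finset.disjoint_left]
    intro y h1 h2
    rcases Finset.mem_union.1 h1 with h1 | h1
    · exact (pA y h1).2.2.1 (pC y h2).1
    · exact (pB y h1).2.2.1 (pC y h2).1
  have d3 : Disjoint (A ∪ B ∪ C) D := by
    rw [Finset.disjoint_left]
    intro y h1 h2
    rcases Finset.mem_union.1 h1 with h1 | h1
    · rcases Finset.mem_union.1 h1 with h1 | h1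
      · exact (pA y h1).2.2.2 (pD y h2).1
      · exact (pB y h1).2.2.2 (pD y h2).1
    · exact (pC y h1).2.2.2 (pD y h2).1
  have d5 : Disjoint (A ∪ B ∪ C ∪ D) ({a, b, c, d} : Finset V) := by
    rw [Finset.disjoint_left]
    intro y h1 h2
    have hn : ∀ u v w z : V, G.Adj u v → G.Adj v w → G.Adj w z → ∀ y, (y = u ∨ y = v ∨ y = w ∨
        y = z) → ¬ (¬ G.Adj u y ∧ ¬ G.Adj v y ∧ ¬ G.Adj w y ∧ ¬ G.Adj z y) := by
      rintro u v w z uv vw wz y (rfl | rfl | rfl | rfl) ⟨h1, h2, h3, h4⟩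
      · exact h2 uv.symm
      · exact h1 uv
      · exact h2 vw
      · exact h3 wz
    simp only [Finset.mem_insert, Finset.mem_singleton] at h2
    simp only [Finset.mem_union] at h1
    rcases h1 with ((h1 | h1) | h1) | h1
    · obtain ⟨e1, e2, e3, e4⟩ := pA y h1
      rcases h2 with rfl | rfl | rfl | rfl
      exacts [G.loopless.irrefl _ e1, e3 bc.symm, e2 bc, e2 bd]
    · obtain ⟨e1, e2, e3, e4⟩ := pB y h1
      rcases h2 with rfl | rfl | rfl | rfl
      exacts [e3 ac.symm, G.loopless.irrefl _ e1, e2 ac, e2 ad]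
    · obtain ⟨e1, e2, e3, e4⟩ := pC y h1
      rcases h2 with rfl | rfl | rfl | rfl
      exacts [e3 ab.symm, e2 ab, G.loopless.irrefl _ e1, e2 ad]
    · obtain ⟨e1, e2, e3, e4⟩ := pD y h1
      rcases h2 with rfl | rfl | rfl | rfl
      exacts [e3 ab.symm, e2 ab, e2 ac, G.loopless.irrefl _ e1]
  have := Finset.card_le_univ (A ∪ B ∪ C ∪ D ∪ ({a, b, c, d} : Finset V))
  rw [Finset.card_union_of_disjoint d5, Finset.card_union_of_disjoint d3,
    Finset.card_union_of_disjoint d2, Finset.card_union_of_disjoint d1] at this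
  omega

theorem three_faces (faces : Finset (Finset V))
    (hface3 : ∀ f ∈ faces, f.card = 3)
    (hfaceclique : ∀ f ∈ faces, ∀ x ∈ f, ∀ y ∈ f, x ≠ y → G.Adj x y)
    (hedge2 : ∀ x y : V, G.Adj x y →
      (faces.filter (fun f => x ∈ f ∧ y ∈ f)).card = 2) :
    3 * faces.card = ∑ v, G.degree v := by
  set D : Finset (V × V) := Finset.univ.filter (fun p => G.Adj p.1 p.2) with hD
  have hDc : D.card = ∑ v, G.degree v := by
    rw [hD, Finset.card_filter, ← Finset.univ_product_univ, Finset.sum_product]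
    apply Finset.sum_congr rfl
    intro v _
    rw [← SimpleGraph.card_neighborFinset_eq_degree, SimpleGraph.neighborFinset_eq_filter,
      Finset.card_filter]
  have h := Finset.sum_card_bipartiteAbove_eq_sum_card_bipartiteBelow
    (s := D) (t := faces) (fun (p : V × V) (f : Finset V) => p.1 ∈ f ∧ p.2 ∈ f)
  have h1 : ∀ p ∈ D, (faces.bipartiteAbove
      (fun (p : V × V) (f : Finset V) => p.1 ∈ f ∧ p.2 ∈ f) p).card = 2 := by
    intro p hp
    exact hedge2 p.1 p.2 (by simpa [hD] using hp)
  have h2 : ∀ f ∈ faces, (D.bipartiteBelow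
      (fun (p : V × V) (f : Finset V) => p.1 ∈ f ∧ p.2 ∈ f) f).card = 6 := by
    intro f hf
    have : D.bipartiteBelow (fun (p : V × V) (f : Finset V) => p.1 ∈ f ∧ p.2 ∈ f) f
        = f.offDiag := by
      ext p
      simp only [Finset.bipartiteBelow, Finset.mem_filter, hD, Finset.mem_univ, true_and,
        Finset.mem_offDiag]
      constructor
      · rintro ⟨h1, h2, h3⟩
        exact ⟨h2, h3, h1.ne⟩
      · rintro ⟨h1, h2, h3⟩
        exact ⟨hfaceclique f hf _ h1 _ h2 h3, h1, h2⟩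
    rw [this, Finset.offDiag_card, hface3 f hf]
  rw [Finset.sum_congr rfl h1, Finset.sum_congr rfl h2, Finset.sum_const, Finset.sum_const,
    hDc] at h
  simp only [smul_eq_mul] at h
  omega

/-- The label of each vertex of the target. -/
def lab : Fin 14 → ℕ := ![0, 13, 1, 2, 3, 4, 5, 6, 7, 8, 9, 10, 11, 12]

theorem lab_lt : ∀ i, lab i < 14 := by decide

theorem lab_inj : ∀ i j, lab i = lab j → i = j := by decide

theorem lab_adj : ∀ i j : Fin 14,
    targetGraph.Adj i j ↔ target.testBit (16 * lab i + lab j) = true := by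
  unfold targetGraph
  simp only [SimpleGraph.fromRel_adj]
  decide +kernel

theorem good_iso (hc : Fintype.card V = 14) (h : Good G 14) : Nonempty (G ≃g targetGraph) := by
  obtain ⟨_, φ, hinj, hadj⟩ := h
  have hbij : Function.Bijective (fun i : Fin 14 => φ (lab i)) := by
    rw [Fintype.bijective_iff_injective_and_card]
    refine ⟨fun i j he => lab_inj i j (hinj _ (lab_lt i) _ (lab_lt j) he), by simp [hc]⟩
  refine ⟨SimpleGraph.Iso.symm ⟨Equiv.ofBijective _ hbij, ?_⟩⟩
  intro i j
  rw [lab_adj, ← hadj _ (lab_lt i) _ (lab_lt j)]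
  rfl

end final

end TriSearch

/-- Theorem 6.1 of Hales, Sphere Packings I (classification due to D. J. Muder).
A triangulation of the sphere is given by a graph `G` together with its finset
of triangular `faces`: each face is a 3-clique, each edge lies on exactly two
faces, and Euler's formula V − E + F = 2 holds.  Under the combinatorial
restrictions of Propositions 4.2 and 5.1 — all degrees in {4,5,6}, 13 ≤ N ≤ 15,
no two adjacent degree-4 vertices, N4 ≤ 2, no patterns (6,6,6) or (6,6,4),
patterns (6,6) and (6,4,4) force N ≥ 14, the condition 5.1.8 on three degree-6
vertices, and every 3-cycle bounding a face — the triangulation must be the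
one of Diagram 6.2, with 14 vertices and 24 triangles. -/
theorem triangulation_classification
    {V : Type*} [Fintype V] [DecidableEq V]
    (G : SimpleGraph V) [DecidableRel G.Adj] [Fintype G.edgeSet]
    (faces : Finset (Finset V))
    (hface3 : ∀ f ∈ faces, f.card = 3)
    (hfaceclique : ∀ f ∈ faces, ∀ x ∈ f, ∀ y ∈ f, x ≠ y → G.Adj x y)
    (hedge2 : ∀ x y : V, G.Adj x y →
      (faces.filter (fun f => x ∈ f ∧ y ∈ f)).card = 2)
    (hEuler : (Fintype.card V : ℤ) - G.edgeFinset.card + faces.card = 2)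
    (hdeg : ∀ v : V, G.degree v = 4 ∨ G.degree v = 5 ∨ G.degree v = 6)
    (hNlo : 13 ≤ Fintype.card V) (hNhi : Fintype.card V ≤ 15)
    (h4adj : ∀ v w : V, G.Adj v w → ¬(G.degree v = 4 ∧ G.degree w = 4))
    (hN4 : (univ.filter (fun v : V => G.degree v = 4)).card ≤ 2)
    (h666 : ¬ ∃ a b c : V, a ≠ b ∧ a ≠ c ∧ b ≠ c ∧
      ¬G.Adj a b ∧ ¬G.Adj a c ∧ ¬G.Adj b c ∧
      G.degree a = 6 ∧ G.degree b = 6 ∧ G.degree c = 6)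
    (h664 : ¬ ∃ a b c : V, a ≠ b ∧ a ≠ c ∧ b ≠ c ∧
      ¬G.Adj a b ∧ ¬G.Adj a c ∧ ¬G.Adj b c ∧
      G.degree a = 6 ∧ G.degree b = 6 ∧ G.degree c = 4)
    (h66 : (∃ a b : V, a ≠ b ∧ ¬G.Adj a b ∧ G.degree a = 6 ∧ G.degree b = 6) →
      14 ≤ Fintype.card V)
    (h644 : (∃ a b c : V, a ≠ b ∧ a ≠ c ∧ b ≠ c ∧
      ¬G.Adj a b ∧ ¬G.Adj a c ∧ ¬G.Adj b c ∧
      G.degree a = 6 ∧ G.degree b = 4 ∧ G.degree c = 4) → 14 ≤ Fintype.card V)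
    (h518 : ∀ a b c : V, G.Adj a b → G.degree a = 6 → G.degree b = 6 →
      G.degree c = 6 → c ≠ a → c ≠ b → ¬G.Adj c a → ¬G.Adj c b →
      Fintype.card V = 15 ∧
        ∀ v : V, v ≠ a → v ≠ b → v ≠ c → G.Adj v a ∨ G.Adj v b ∨ G.Adj v c)
    (htri : ∀ x y z : V, x ≠ y → y ≠ z → x ≠ z →
      G.Adj x y → G.Adj y z → G.Adj x z → ({x, y, z} : Finset V) ∈ faces) :
    Fintype.card V = 14 ∧ faces.card = 24 ∧ Nonempty (G ≃g targetGraph) := by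
  have hc2 := TriSearch.common_two faces hface3 hfaceclique hedge2 htri
  have hd4 : ∀ v, 4 ≤ G.degree v := fun v => by rcases hdeg v with h | h | h <;> omega
  have hd6 : ∀ v, G.degree v ≤ 6 := fun v => by rcases hdeg v with h | h | h <;> omega
  have T : TriSearch.Tri G (Fintype.card V) := by
    refine ⟨rfl, hNhi, hc2, TriSearch.no_k4 hc2 hd4 hNhi, hd4, hd6, h4adj, ?_, ?_, ?_, ?_, h518⟩
    · intro a b c ab ac bc da db dc
      have hsub : ({a, b, c} : Finset V) ⊆ univ.filter (fun v : V => G.degree v = 4) := by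
        intro z hz
        simp only [Finset.mem_insert, Finset.mem_singleton] at hz
        rw [Finset.mem_filter]
        rcases hz with rfl | rfl | rfl
        exacts [⟨Finset.mem_univ _, da⟩, ⟨Finset.mem_univ _, db⟩, ⟨Finset.mem_univ _, dc⟩]
      have h1 := Finset.card_le_card hsub
      rw [Finset.card_eq_three.2 ⟨a, b, c, ab, ac, bc, rfl⟩] at h1
      omega
    · intro a b c ab ac bc nab nac nbc da db dc
      exact h666 ⟨a, b, c, ab, ac, bc, nab, nac, nbc, da, db, dc⟩
    · intro a b c ab ac bc nab nac nbc da db dc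
      exact h664 ⟨a, b, c, ab, ac, bc, nab, nac, nbc, da, db, dc⟩
    · intro a b ab nab da db
      have := h66 ⟨a, b, ab, nab, da, db⟩
      omega
  have h3F := TriSearch.three_faces faces hface3 hfaceclique hedge2
  have hsum : ∑ v, G.degree v = 2 * G.edgeFinset.card := by
    convert G.sum_degrees_eq_twice_card_edges
  have hgood : TriSearch.Good G (Fintype.card V) := by
    apply TriSearch.search_good T hNlo
    by_cases h4 : ∃ v, G.degree v = 4
    · exact Or.inl h4
    · right
      push Not at h4
      refine ⟨h4, ?_⟩
      by_contra h6
      push Not at h6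
      have h5 : ∀ v ∈ (univ : Finset V), G.degree v = 5 := by
        intro v _
        rcases hdeg v with h | h | h
        · exact absurd h (h4 v)
        · exact h
        · exact absurd h (h6 v)
      rw [Finset.sum_congr rfl h5, Finset.sum_const, Finset.card_univ, smul_eq_mul] at hsum h3F
      omega
  have h14 := hgood.1
  refine ⟨h14, by omega, TriSearch.good_iso h14 (by rw [← h14]; exact hgood)⟩
end
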